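/- For integers n ≥ 2 and d ≥ 2, the finite poset (M_d^n, A_{n,d}) has height (n−1)d (its longest chains contain (n−1)d + 1 elements) and width equal to the number of partitions of ⌊(n−1)d/2⌋ whose Young diagram fits inside a d × (n−1) box (i.e., the middle Gaussian binomial coefficient c_w^{(n-1,d)}, w = ⌊(n−1)d/2⌋). -/

import Mathlib

/-- The free abelian monoid `M` on variables `x₁, x₂, …`, identified with
finitely supported exponent vectors; index `i : ℕ` represents the variable `x_{i+1}`. -/
abbrev Mon : Type := ℕ →₀ ℕ

/-- Total degree of a monomial. -/
def deg (m : Mon) : ℕ := m.sum fun _ v => v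

/-- `m` is a monomial in the first `n` variables, i.e. `m ∈ Mⁿ`. -/
def InVars (n : ℕ) (m : Mon) : Prop := ∀ i ∈ m.support, i < n

/-- Elementary move: `m = (x_i / x_j) · m'` for some `i < j` with `x_j ∣ m'`. -/
def ElemMove (m m' : Mon) : Prop :=
  ∃ i j : ℕ, i < j ∧ m + Finsupp.single j 1 = m' + Finsupp.single i 1

/-- Stable move: `m = (x_i / x_s) · m'` where `s = maxsupp m'` and `i < s`. -/
def StableMove (m m' : Mon) : Prop :=
  ∃ s i : ℕ, i < s ∧ m' s ≠ 0 ∧ (∀ t, s < t → m' t = 0) ∧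
    m + Finsupp.single s 1 = m' + Finsupp.single i 1

/-- The divisibility relation `D`: `(m, m') ∈ D` iff `m'` divides `m`. -/
def Dvd' (m m' : Mon) : Prop := ∃ t : Mon, m = m' + t

/-- A linearly independent family of polynomials admits an injective choice of monomials
occurring in its members. -/
theorem exists_injective_mem_support {ι σ K : Type*} [Field K] {v : ι → MvPolynomial σ K}
    (hv : LinearIndependent K v) :
    ∃ f : ι → σ →₀ ℕ, Function.Injective f ∧ ∀ i, f i ∈ (v i).support := by
  classical
  refine (Finset.all_card_le_biUnion_card_iff_exists_injective fun i => (v i).support).1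
    fun s => ?_
  set U := s.biUnion fun i => (v i).support with hU
  let b := MvPolynomial.basisRestrictSupport K (U : Set (σ →₀ ℕ))
  have hmem : ∀ i : s, v i ∈ MvPolynomial.restrictSupport K (U : Set (σ →₀ ℕ)) := fun i =>
    (MvPolynomial.mem_restrictSupport_iff _).2 <| by
      exact_mod_cast Finset.subset_biUnion_of_mem (fun i => (v i).support) i.2
  let w : s → MvPolynomial.restrictSupport K (U : Set (σ →₀ ℕ)) := fun i => ⟨v i, hmem i⟩
  have hw : LinearIndependent K w :=
    LinearIndependent.of_comp (Submodule.subtype _) (hv.comp _ Subtype.val_injective)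
  have : Module.Finite K (MvPolynomial.restrictSupport K (U : Set (σ →₀ ℕ))) :=
    Module.Finite.of_basis b
  have h := hw.fintype_card_le_finrank
  rw [Module.finrank_eq_card_basis b] at h
  simpa using h

/-- If `F` lowers a grading that vanishes in degree `0` and the commutator of `F` and `E`
acts by positive scalars up to degree `k`, then `E` is injective in degree `k`. -/
theorem eq_zero_of_commutator_pos {K P : Type*} [Field K] [LinearOrder K] [IsStrictOrderedRing K]
    [AddCommGroup P] [Module K P] {V : ℕ → Submodule K P} {E F : P →ₗ[K] P} {c : ℕ → K} {k : ℕ}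
    (hV : V 0 = ⊥) (hF : ∀ j, ∀ v ∈ V (j + 1), F v ∈ V j)
    (hc : ∀ j, ∀ v ∈ V j, F (E v) = E (F v) + c j • v) (hpos : ∀ j ≤ k, 0 < c j)
    {v : P} (hv : v ∈ V k) (hEv : E v = 0) : v = 0 := by
  have key : ∀ j ≤ k, ∀ t : K, 0 < t → ∀ v ∈ V j, E (F v) = -(t • v) → v = 0 := by
    intro j
    induction j with
    | zero => intro _ t _ v hv _; simpa [hV] using hv
    | succ j ih =>
      intro hj t ht v hv h
      have hu := hF j v hv
      have hu0 : F v = 0 := by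
        refine ih (by omega) (t + c j) (add_pos ht (hpos j (by omega))) _ hu ?_
        have h2 := hc j _ hu
        rw [h, map_neg, map_smul] at h2
        rw [add_smul, neg_add, h2]
        abel
      rw [hu0, map_zero, eq_comm, neg_eq_zero] at h
      exact (smul_eq_zero.1 h).resolve_left ht.ne'
  refine key k le_rfl (c k) (hpos k le_rfl) v hv ?_
  have := hc k v hv
  rw [hEv, map_zero] at this
  exact eq_neg_of_add_eq_zero_left this.symm

/-- The rank of a monomial: the sum of the indices of its variables. -/
noncomputable def monRank : Mon →+ ℕ := Finsupp.weight (id : ℕ → ℕ)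

theorem monRank_single (i k : ℕ) : monRank (Finsupp.single i k) = k * i := by
  simp [monRank, Finsupp.weight_single]

theorem deg_eq_degree (m : Mon) : deg m = Finsupp.degree m := rfl

theorem deg_add_single (m : Mon) (i : ℕ) : deg (m + Finsupp.single i 1) = deg m + 1 := by
  simp [deg_eq_degree]

theorem monRank_add_single (m : Mon) (i : ℕ) :
    monRank (m + Finsupp.single i 1) = monRank m + i := by
  simp [monRank_single]

theorem monRank_le {q d : ℕ} {m : Mon} (hm : InVars (q + 1) m) (hd : deg m = d) :
    monRank m ≤ q * d := by
  rw [← hd, deg, Finsupp.sum, Finset.mul_sum, monRank, Finsupp.weight_apply, Finsupp.sum]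
  refine Finset.sum_le_sum fun i hi => ?_
  have := hm i hi
  simp only [smul_eq_mul, id, mul_comm q]
  exact Nat.mul_le_mul_left _ (by omega)

/-- The derivation sending the `i`-th variable to `c i` times the `σ i`-th variable. -/
noncomputable def shiftDerivation (c : ℕ → ℚ) (σ : ℕ → ℕ) :
    Derivation ℚ (MvPolynomial ℕ ℚ) (MvPolynomial ℕ ℚ) :=
  MvPolynomial.mkDerivation ℚ fun i => MvPolynomial.monomial (Finsupp.single (σ i) 1) (c i)

theorem exists_of_mem_support_shiftDerivation {c : ℕ → ℚ} {σ : ℕ → ℕ} {m m' : Mon}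
    (h : m' ∈ (shiftDerivation c σ (MvPolynomial.monomial m 1)).support) :
    ∃ i, i ∈ m.support ∧ c i ≠ 0 ∧ m' + Finsupp.single i 1 = m + Finsupp.single (σ i) 1 := by
  classical
  rw [shiftDerivation, MvPolynomial.mkDerivation_monomial, one_smul, Finsupp.sum] at h
  obtain ⟨i, hi, h⟩ := Finset.mem_biUnion.1 (MvPolynomial.support_sum h)
  rw [smul_eq_mul, MvPolynomial.monomial_mul, MvPolynomial.support_monomial] at h
  split_ifs at h with h0
  · simp at h
  · refine ⟨i, hi, right_ne_zero_of_mul h0, ?_⟩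
    rw [Finset.mem_singleton.1 h, add_right_comm, tsub_add_cancel_of_le]
    rw [Finsupp.single_le_iff]
    exact Nat.one_le_iff_ne_zero.2 (Finsupp.mem_support_iff.1 hi)

/-- The derivation raising the rank by one on polynomials in `q + 1` variables. -/
noncomputable def raiseDer (q : ℕ) : Derivation ℚ (MvPolynomial ℕ ℚ) (MvPolynomial ℕ ℚ) :=
  shiftDerivation (fun i => (i + 1) * (q - i)) (· + 1)

/-- The derivation lowering the rank by one. -/
noncomputable def lowerDer : Derivation ℚ (MvPolynomial ℕ ℚ) (MvPolynomial ℕ ℚ) :=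
  shiftDerivation (fun i => if i = 0 then 0 else 1) (· - 1)

theorem lie_lowerDer_raiseDer (q : ℕ) :
    ⁅lowerDer, raiseDer q⁆ = shiftDerivation (fun i => q - 2 * i) id := by
  refine MvPolynomial.derivation_ext fun i => ?_
  have hmon : ∀ (j : ℕ) (a : ℚ), MvPolynomial.monomial (Finsupp.single j 1) a
      = a • (MvPolynomial.X j : MvPolynomial ℕ ℚ) := fun j a => by
    rw [MvPolynomial.X, MvPolynomial.smul_monomial, smul_eq_mul, mul_one]
  rw [Derivation.commutator_apply]
  rcases i with _ | i
  · simp [lowerDer, raiseDer, shiftDerivation, hmon]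
  · simp only [lowerDer, raiseDer, shiftDerivation, hmon, MvPolynomial.mkDerivation_X, Derivation.map_smul,
      Nat.add_sub_cancel, id, smul_smul, ← sub_smul, Nat.succ_ne_zero, if_false]
    congr 1
    push_cast
    ring

theorem lie_apply_monomial (q : ℕ) (m : Mon) :
    ⁅lowerDer, raiseDer q⁆ (MvPolynomial.monomial m 1) =
      ((q * deg m : ℚ) - 2 * monRank m) • MvPolynomial.monomial m (1 : ℚ) := by
  rw [lie_lowerDer_raiseDer, shiftDerivation, MvPolynomial.mkDerivation_monomial, one_smul,
    deg, monRank, Finsupp.weight_apply, Finsupp.sum, Finsupp.sum, Finsupp.sum]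
  push_cast
  rw [Finset.mul_sum, Finset.mul_sum, ← Finset.sum_sub_distrib, Finset.sum_smul]
  refine Finset.sum_congr rfl fun i hi => ?_
  have h1 : Finsupp.single i 1 ≤ m := by
    rw [Finsupp.single_le_iff]
    exact Nat.one_le_iff_ne_zero.2 (Finsupp.mem_support_iff.1 hi)
  rw [smul_eq_mul, MvPolynomial.monomial_mul, id, tsub_add_cancel_of_le h1,
    MvPolynomial.smul_monomial]
  congr 1
  simp
  ring

/-- Polynomials homogeneous of degree `d` in the first `n` variables, all of whose monomials
have a rank satisfying `p`. -/
noncomputable def rankSpace (n d : ℕ) (p : ℕ → Prop) : Submodule ℚ (MvPolynomial ℕ ℚ) :=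
  MvPolynomial.restrictSupport ℚ {m : Mon | InVars n m ∧ deg m = d ∧ p (monRank m)}

theorem monomial_mem_rankSpace {n d : ℕ} {p : ℕ → Prop} {m : Mon} (h1 : InVars n m)
    (h2 : deg m = d) (h3 : p (monRank m)) :
    MvPolynomial.monomial m (1 : ℚ) ∈ rankSpace n d p :=
  (MvPolynomial.monomial_mem_restrictSupport _).2 (Or.inl ⟨h1, h2, h3⟩)

theorem rankSpace_induction {n d : ℕ} {p : ℕ → Prop} {W : Submodule ℚ (MvPolynomial ℕ ℚ)}
    (h : ∀ m, InVars n m → deg m = d → p (monRank m) → MvPolynomial.monomial m 1 ∈ W) :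
    rankSpace n d p ≤ W := by
  rw [rankSpace, MvPolynomial.restrictSupport_eq_span, Submodule.span_le]
  rintro _ ⟨m, ⟨h1, h2, h3⟩, rfl⟩
  exact h m h1 h2 h3

theorem rankSpace_eq_bot {q d : ℕ} {p : ℕ → Prop} (h : ∀ k ≤ q * d, ¬ p k) :
    rankSpace (q + 1) d p = ⊥ :=
  le_bot_iff.1 <| rankSpace_induction fun _ h1 h2 h3 => (h _ (monRank_le h1 h2) h3).elim

theorem lower_raise_apply {n d q : ℕ} {p : ℕ → Prop} {k : ℚ} (hp : ∀ r, p r → (r : ℚ) = k)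
    {v : MvPolynomial ℕ ℚ} (hv : v ∈ rankSpace n d p) :
    lowerDer (raiseDer q v) = raiseDer q (lowerDer v) + ((q * d : ℚ) - 2 * k) • v := by
  rw [← sub_eq_iff_eq_add', ← Derivation.commutator_apply]
  refine rankSpace_induction (W := LinearMap.eqLocus
    (⁅lowerDer, raiseDer q⁆ : Derivation ℚ _ _).toLinearMap
    (((q * d : ℚ) - 2 * k) • LinearMap.id)) ?_ hv
  intro m _ h2 h3
  have := lie_apply_monomial q m
  rw [h2, hp _ h3] at this
  exact this

theorem of_mem_support_raiseDer {q d : ℕ} {m m' : Mon} (hm : InVars (q + 1) m) (hd : deg m = d)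
    (h : m' ∈ (raiseDer q (MvPolynomial.monomial m 1)).support) :
    InVars (q + 1) m' ∧ deg m' = d ∧ monRank m' = monRank m + 1 ∧ ElemMove m m' := by
  obtain ⟨i, hi, hc, he⟩ := exists_of_mem_support_shiftDerivation h
  have hiq : i < q := by
    have h1 := hm i hi
    have h2 : i ≠ q := by rintro rfl; simp at hc
    omega
  have hdeg := congrArg deg he
  have hrk := congrArg monRank he
  rw [deg_add_single, deg_add_single] at hdeg
  rw [monRank_add_single, monRank_add_single] at hrk
  refine ⟨fun t ht => ?_, by omega, by omega, i, i + 1, by omega, he.symm⟩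
  have h3 := DFunLike.congr_fun he t
  by_contra hlt
  have h4 : m t = 0 := by
    by_contra h0
    exact hlt (hm t (Finsupp.mem_support_iff.2 h0))
  have h5 := Finsupp.mem_support_iff.1 ht
  simp only [Finsupp.add_apply, h4, Finsupp.single_apply] at h3
  split_ifs at h3 <;> omega

theorem InVars.of_elemMove {n : ℕ} {m m' : Mon} (h : InVars n m') (hm : ElemMove m m') :
    InVars n m := by
  obtain ⟨i, j, hij, he⟩ := hm
  have hz : ∀ t, n ≤ t → m' t = 0 := fun t ht => by
    by_contra h0
    exact absurd (h t (Finsupp.mem_support_iff.2 h0)) (by omega)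
  intro t ht
  have h5 := Finsupp.mem_support_iff.1 ht
  by_contra hlt
  have h3 := DFunLike.congr_fun he t
  have h6 := DFunLike.congr_fun he j
  have h7 := hz t (by omega)
  have h8 := hz j
  simp only [Finsupp.add_apply, Finsupp.single_apply] at h3 h6
  split_ifs at h3 h6 <;> omega

theorem of_mem_support_lowerDer {n d : ℕ} {m m' : Mon} (hm : InVars n m) (hd : deg m = d)
    (h : m' ∈ (lowerDer (MvPolynomial.monomial m 1)).support) :
    InVars n m' ∧ deg m' = d ∧ monRank m' + 1 = monRank m ∧ ElemMove m' m := by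
  obtain ⟨i, hi, hc, he⟩ := exists_of_mem_support_shiftDerivation h
  have hi0 : i ≠ 0 := by rintro rfl; simp at hc
  have hdeg := congrArg deg he
  have hrk := congrArg monRank he
  rw [deg_add_single, deg_add_single] at hdeg
  rw [monRank_add_single, monRank_add_single] at hrk
  have hmove : ElemMove m' m := ⟨i - 1, i, by omega, he⟩
  exact ⟨hm.of_elemMove hmove, by omega, by omega, hmove⟩

theorem mem_rankSpace_of_support {n d : ℕ} {p : ℕ → Prop} {v : MvPolynomial ℕ ℚ}
    (h : ∀ m ∈ v.support, InVars n m ∧ deg m = d ∧ p (monRank m)) : v ∈ rankSpace n d p :=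
  (MvPolynomial.mem_restrictSupport_iff _).2 fun m hm => h m hm

theorem raiseDer_mem {q d : ℕ} {p p' : ℕ → Prop} (hp : ∀ r, p r → p' (r + 1))
    {v : MvPolynomial ℕ ℚ} (hv : v ∈ rankSpace (q + 1) d p) :
    raiseDer q v ∈ rankSpace (q + 1) d p' := by
  refine rankSpace_induction (W := (rankSpace (q + 1) d p').comap (raiseDer q).toLinearMap) ?_ hv
  intro m h1 h2 h3
  refine mem_rankSpace_of_support fun m' hm' => ?_
  obtain ⟨g1, g2, g3, -⟩ := of_mem_support_raiseDer h1 h2 hm'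
  exact ⟨g1, g2, g3 ▸ hp _ h3⟩

theorem lowerDer_mem {n d : ℕ} {p p' : ℕ → Prop} (hp : ∀ r, p (r + 1) → p' r)
    {v : MvPolynomial ℕ ℚ} (hv : v ∈ rankSpace n d p) : lowerDer v ∈ rankSpace n d p' := by
  refine rankSpace_induction (W := (rankSpace n d p').comap lowerDer.toLinearMap) ?_ hv
  intro m h1 h2 h3
  refine mem_rankSpace_of_support fun m' hm' => ?_
  obtain ⟨g1, g2, g3, -⟩ := of_mem_support_lowerDer h1 h2 hm'
  exact ⟨g1, g2, hp _ (g3 ▸ h3)⟩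

theorem raiseDer_injective {q d k : ℕ} (hk : 2 * k < q * d) {v : MvPolynomial ℕ ℚ}
    (hv : v ∈ rankSpace (q + 1) d (· = k)) (h : raiseDer q v = 0) : v = 0 := by
  refine eq_zero_of_commutator_pos (V := fun j => rankSpace (q + 1) d (· + 1 = j))
    (E := (raiseDer q).toLinearMap) (F := lowerDer.toLinearMap)
    (c := fun j => (q * d : ℚ) - 2 * ((j : ℚ) - 1)) (k := k + 1)
    (rankSpace_eq_bot fun _ _ => by omega) (fun j v hv => lowerDer_mem (by intros; omega) hv)
    (fun j v hv => lower_raise_apply (by rintro r rfl; simp) hv) ?_ (by simpa using hv) h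
  intro j hj
  have : ((2 * j : ℕ) : ℚ) < (q * d + 2 : ℕ) := by exact_mod_cast by omega
  push_cast at this
  linarith

theorem lowerDer_injective {q d k : ℕ} (hk : q * d < 2 * k) {v : MvPolynomial ℕ ℚ}
    (hv : v ∈ rankSpace (q + 1) d (· = k)) (h : lowerDer v = 0) : v = 0 := by
  by_cases hkq : q * d < k
  · simpa [rankSpace_eq_bot (q := q) (d := d) (p := (· = k)) (by intros; omega)] using hv
  refine eq_zero_of_commutator_pos (V := fun j => rankSpace (q + 1) d (· + j = q * d + 1))
    (F := (raiseDer q).toLinearMap) (E := lowerDer.toLinearMap)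
    (c := fun j => (q * d : ℚ) - 2 * ((j : ℚ) - 1)) (k := q * d + 1 - k)
    (rankSpace_eq_bot fun _ _ => by omega) (fun j v hv => raiseDer_mem (by intros; omega) hv)
    (fun j v hv => ?_) ?_ ?_ h
  · have := lower_raise_apply (q := q) (k := q * d + 1 - j) (fun r hr => ?_) hv
    · simp only [Derivation.coeFn_coe]
      rw [this, add_assoc, ← add_smul]
      ring_nf
      simp
    · rw [eq_sub_iff_add_eq]
      exact_mod_cast hr
  · intro j hj
    have : ((2 * j : ℕ) : ℚ) < (q * d + 2 : ℕ) := by exact_mod_cast by omega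
    push_cast at this
    linarith
  · have : (fun r => r + (q * d + 1 - k) = q * d + 1) = (· = k) := by
      funext r
      exact propext (by omega)
    simpa [this] using hv

theorem linearIndependent_apply_monomial {n d : ℕ} {p : ℕ → Prop}
    (D : Derivation ℚ (MvPolynomial ℕ ℚ) (MvPolynomial ℕ ℚ))
    (hD : ∀ v ∈ rankSpace n d p, D v = 0 → v = 0) :
    LinearIndependent ℚ fun m : {m : Mon // InVars n m ∧ deg m = d ∧ p (monRank m)} =>
      D (MvPolynomial.monomial m.1 1) := by
  have h1 : LinearIndependent ℚ
      fun m : {m : Mon // InVars n m ∧ deg m = d ∧ p (monRank m)} =>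
        (MvPolynomial.monomial m.1 1 : MvPolynomial ℕ ℚ) := by
    have := (MvPolynomial.basisMonomials ℕ ℚ).linearIndependent
    rw [MvPolynomial.coe_basisMonomials] at this
    exact this.comp _ Subtype.val_injective
  refine h1.map (f := D.toLinearMap) ?_
  rw [Submodule.disjoint_def]
  intro v hv hker
  refine hD v (Submodule.span_le.2 ?_ hv) hker
  rintro _ ⟨m, rfl⟩
  exact monomial_mem_rankSpace m.2.1 m.2.2.1 m.2.2.2

/-- Below the middle rank, the monomials of a given rank can be matched injectively with
monomials of the next rank lying on the other side of an elementary move. -/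
theorem exists_raise (q d : ℕ) : ∃ h : {m : Mon // InVars (q + 1) m ∧ deg m = d} →
      {m : Mon // InVars (q + 1) m ∧ deg m = d},
    (∀ x, 2 * monRank x.1 < q * d →
      monRank (h x).1 = monRank x.1 + 1 ∧ ElemMove x.1 (h x).1) ∧
    ∀ x y, 2 * monRank x.1 < q * d → monRank x.1 = monRank y.1 → h x = h y → x = y := by
  have hex : ∀ k, 2 * k < q * d →
      ∃ f : {m : Mon // InVars (q + 1) m ∧ deg m = d ∧ monRank m = k} → Mon,
        Function.Injective f ∧ ∀ m, InVars (q + 1) (f m) ∧ deg (f m) = d ∧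
          monRank (f m) = monRank m.1 + 1 ∧ ElemMove m.1 (f m) := fun k hk => by
    obtain ⟨f, hf, hmem⟩ := exists_injective_mem_support
      (linearIndependent_apply_monomial (p := (· = k)) (raiseDer q)
        fun v hv => raiseDer_injective hk hv)
    exact ⟨f, hf, fun m => of_mem_support_raiseDer m.2.1 m.2.2.1 (hmem m)⟩
  choose f hinj hf using hex
  refine ⟨fun x => if hx : 2 * monRank x.1 < q * d then
    ⟨f _ hx ⟨x.1, x.2.1, x.2.2, rfl⟩, (hf _ hx _).1, (hf _ hx _).2.1⟩ else x, ?_, ?_⟩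
  · intro x hx
    simp only [hx, dif_pos]
    exact (hf _ hx ⟨x.1, x.2.1, x.2.2, rfl⟩).2.2
  · intro x y hx hxy h
    have hy := hxy ▸ hx
    simp only [hx, hy, dif_pos, Subtype.mk.injEq] at h
    have key : ∀ a b (ha : 2 * a < q * d) (hb : 2 * b < q * d) (hxa : monRank x.1 = a)
        (hyb : monRank y.1 = b), a = b → f a ha ⟨x.1, x.2.1, x.2.2, hxa⟩ =
          f b hb ⟨y.1, y.2.1, y.2.2, hyb⟩ → x = y := by
      rintro a _ ha hb hxa hyb rfl he
      exact Subtype.ext (Subtype.mk.inj (hinj a ha he))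
    exact key _ _ hx hy rfl rfl hxy h

/-- Above the middle rank, the monomials of a given rank can be matched injectively with
monomials of the previous rank lying on the other side of an elementary move. -/
theorem exists_lower (q d : ℕ) : ∃ h : {m : Mon // InVars (q + 1) m ∧ deg m = d} →
      {m : Mon // InVars (q + 1) m ∧ deg m = d},
    (∀ x, q * d < 2 * monRank x.1 →
      monRank (h x).1 + 1 = monRank x.1 ∧ ElemMove (h x).1 x.1) ∧
    ∀ x y, q * d < 2 * monRank x.1 → monRank x.1 = monRank y.1 → h x = h y → x = y := by
  have hex : ∀ k, q * d < 2 * k →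
      ∃ f : {m : Mon // InVars (q + 1) m ∧ deg m = d ∧ monRank m = k} → Mon,
        Function.Injective f ∧ ∀ m, InVars (q + 1) (f m) ∧ deg (f m) = d ∧
          monRank (f m) + 1 = monRank m.1 ∧ ElemMove (f m) m.1 := fun k hk => by
    obtain ⟨f, hf, hmem⟩ := exists_injective_mem_support
      (linearIndependent_apply_monomial (p := (· = k)) lowerDer
        fun v hv => lowerDer_injective hk hv)
    exact ⟨f, hf, fun m => of_mem_support_lowerDer m.2.1 m.2.2.1 (hmem m)⟩
  choose f hinj hf using hex
  refine ⟨fun x => if hx : q * d < 2 * monRank x.1 then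
    ⟨f _ hx ⟨x.1, x.2.1, x.2.2, rfl⟩, (hf _ hx _).1, (hf _ hx _).2.1⟩ else x, ?_, ?_⟩
  · intro x hx
    simp only [hx, dif_pos]
    exact (hf _ hx ⟨x.1, x.2.1, x.2.2, rfl⟩).2.2
  · intro x y hx hxy h
    have hy := hxy ▸ hx
    simp only [hx, hy, dif_pos, Subtype.mk.injEq] at h
    have key : ∀ a b (ha : q * d < 2 * a) (hb : q * d < 2 * b) (hxa : monRank x.1 = a)
        (hyb : monRank y.1 = b), a = b → f a ha ⟨x.1, x.2.1, x.2.2, hxa⟩ =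
          f b hb ⟨y.1, y.2.1, y.2.2, hyb⟩ → x = y := by
      rintro a _ ha hb hxa hyb rfl he
      exact Subtype.ext (Subtype.mk.inj (hinj a ha he))
    exact key _ _ hx hy rfl rfl hxy h

section Iterate

variable {T : Type*} {R : T → T → Prop} {s : T → ℕ} {h : T → T}

theorem iterate_height (hs : ∀ x, s x ≠ 0 → s (h x) + 1 = s x ∧ R x (h x)) (j : ℕ) (x : T)
    (hj : j ≤ s x) : s (h^[j] x) + j = s x ∧ Relation.ReflTransGen R x (h^[j] x) := by
  induction j with
  | zero => exact ⟨rfl, .refl⟩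
  | succ j ih =>
    obtain ⟨h1, h2⟩ := ih (by omega)
    obtain ⟨h3, h4⟩ := hs (h^[j] x) (by omega)
    rw [Function.iterate_succ_apply']
    exact ⟨by omega, h2.tail h4⟩

theorem iterate_injective (hs : ∀ x, s x ≠ 0 → s (h x) + 1 = s x ∧ R x (h x))
    (hinj : ∀ x y, s x ≠ 0 → s x = s y → h x = h y → x = y) (j : ℕ) (x y : T) (hj : j ≤ s x)
    (hxy : s x = s y) (he : h^[j] x = h^[j] y) : x = y := by
  induction j generalizing x y with
  | zero => exact he
  | succ j ih =>
    have h1 := (hs x (by omega)).1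
    have h2 := (hs y (by omega)).1
    exact hinj x y (by omega) hxy (ih _ _ (by omega) (by omega) he)

/-- Two elements that a level-wise injective map takes to the same element of height `0`
lie on a common orbit. -/
theorem reflTransGen_of_iterate_eq (hs : ∀ x, s x ≠ 0 → s (h x) + 1 = s x ∧ R x (h x))
    (hinj : ∀ x y, s x ≠ 0 → s x = s y → h x = h y → x = y) {x y : T} (hxy : s x ≤ s y)
    (he : h^[s x] x = h^[s y] y) : Relation.ReflTransGen R y x := by
  obtain ⟨j, hj⟩ := Nat.exists_eq_add_of_le hxy
  obtain ⟨h1, h2⟩ := iterate_height hs j y (by omega)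
  rw [hj, Function.iterate_add_apply] at he
  rwa [iterate_injective hs hinj (s x) x _ le_rfl (by omega) he]

end Iterate

theorem monRank_of_elemMove {m m' : Mon} (h : ElemMove m m') : monRank m < monRank m' := by
  obtain ⟨i, j, hij, he⟩ := h
  have := congrArg monRank he
  rw [monRank_add_single, monRank_add_single] at this
  omega

theorem eq_or_monRank_lt {m m' : Mon} (h : Relation.ReflTransGen ElemMove m m') :
    m = m' ∨ monRank m < monRank m' := by
  induction h with
  | refl => exact .inl rfl
  | tail _ h ih =>
    have := monRank_of_elemMove h
    rcases ih with rfl | ih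
    · exact .inr this
    · exact .inr (ih.trans this)

theorem deg_eq_card (m : Mon) : deg m = Multiset.card (Finsupp.toMultiset m) :=
  (Finsupp.card_toMultiset m).symm

theorem monRank_eq_sum (m : Mon) : monRank m = (Finsupp.toMultiset m).sum := by
  rw [Finsupp.sum_toMultiset, monRank, Finsupp.weight_apply]
  rfl

/-- The monomials of rank `w` correspond to the partitions of `w` in a box. -/
theorem nonempty_partitions_equiv (q d w : ℕ) : Nonempty <|
    {l : Fin d → ℕ // (∀ i j : Fin d, i ≤ j → l j ≤ l i) ∧ (∀ i, l i ≤ q) ∧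
      ∑ i, l i = w} ≃
    {m : {m : Mon // InVars (q + 1) m ∧ deg m = d} // monRank m.1 = w} := by
  classical
  let F : (Fin d → ℕ) → Mon := fun l => Multiset.toFinsupp (List.ofFn l : Multiset ℕ)
  have hF : ∀ l, Finsupp.toMultiset (F l) = (List.ofFn l : Multiset ℕ) := fun l =>
    Multiset.toFinsupp_toMultiset _
  have hvar : ∀ l : Fin d → ℕ, InVars (q + 1) (F l) ↔ ∀ i, l i ≤ q := fun l => by
    simp only [InVars, ← Finsupp.mem_toMultiset, hF, Multiset.mem_coe, List.mem_ofFn,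
      Nat.lt_succ_iff, forall_exists_index, forall_apply_eq_imp_iff]
  have hdeg : ∀ l : Fin d → ℕ, deg (F l) = d := fun l => by
    rw [deg_eq_card, hF, Multiset.coe_card, List.length_ofFn]
  have hrk : ∀ l : Fin d → ℕ, monRank (F l) = ∑ i, l i := fun l => by
    rw [monRank_eq_sum, hF, Multiset.sum_coe, List.sum_ofFn]
  refine ⟨Equiv.ofBijective
    (fun l => ⟨⟨F l.1, (hvar _).2 l.2.2.1, hdeg _⟩, (hrk _).trans l.2.2.2⟩) ⟨?_, ?_⟩⟩
  · rintro ⟨l, hl, _⟩ ⟨l', hl', _⟩ h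
    simp only [Subtype.mk.injEq] at h
    have h1 : (List.ofFn l : Multiset ℕ) = (List.ofFn l' : Multiset ℕ) := by rw [← hF, h, hF]
    have h2 : Antitone l := fun i j => hl i j
    have h3 : Antitone l' := fun i j => hl' i j
    exact Subtype.ext <| List.ofFn_injective <|
      (Multiset.coe_eq_coe.1 h1).eq_of_sortedGE h2.sortedGE_ofFn h3.sortedGE_ofFn
  · rintro ⟨⟨m, h1, h2⟩, h3⟩
    set L := (Finsupp.toMultiset m).sort (· ≥ ·) with hL
    have hlen : L.length = d := by rw [hL, Multiset.length_sort, ← deg_eq_card, h2]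
    subst hlen
    have hsort : L.SortedGE := (Multiset.pairwise_sort _ _).sortedGE
    have hm : F L.get = m := by
      change Multiset.toFinsupp _ = m
      rw [List.ofFn_get, hL, Multiset.sort_eq, Finsupp.toMultiset_toFinsupp]
    refine ⟨⟨L.get, fun i j hij => hsort.antitone_get hij, (hvar _).1 (hm ▸ h1),
      by rw [← hrk, hm, h3]⟩, ?_⟩
    exact Subtype.ext (Subtype.ext hm)

theorem exists_elemMove {n d : ℕ} (x : {m : Mon // InVars n m ∧ deg m = d})
    (hx : monRank x.1 ≠ 0) : ∃ y : {m : Mon // InVars n m ∧ deg m = d},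
      monRank y.1 + 1 = monRank x.1 ∧ ElemMove y.1 x.1 := by
  obtain ⟨m, hm, hd⟩ := x
  obtain ⟨i, hi, hi0⟩ : ∃ i ∈ m.support, i ≠ 0 := by
    by_contra! h
    refine hx ?_
    rw [monRank, Finsupp.weight_apply]
    exact Finset.sum_eq_zero fun i hi => by simp [h i hi]
  have h1 : Finsupp.single i 1 ≤ m := by
    rw [Finsupp.single_le_iff]
    exact Nat.one_le_iff_ne_zero.2 (Finsupp.mem_support_iff.1 hi)
  obtain ⟨t, rfl⟩ : ∃ t, m = t + Finsupp.single i 1 := ⟨_, (tsub_add_cancel_of_le h1).symm⟩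
  have hmove : ElemMove (t + Finsupp.single (i - 1) 1) (t + Finsupp.single i 1) :=
    ⟨i - 1, i, by omega, add_right_comm _ _ _⟩
  refine ⟨⟨_, hm.of_elemMove hmove, ?_⟩, ?_, hmove⟩
  · rw [deg_add_single] at hd ⊢
    exact hd
  · rw [monRank_add_single, monRank_add_single]
    omega

theorem card_antichain_le (q d : ℕ) (A : Finset {m : Mon // InVars (q + 1) m ∧ deg m = d})
    (hA : ∀ a ∈ A, ∀ b ∈ A, a ≠ b → ¬ Relation.ReflTransGen ElemMove a.1 b.1)
    [Finite {m : {m : Mon // InVars (q + 1) m ∧ deg m = d} // monRank m.1 = q * d / 2}] :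
    A.card ≤
      Nat.card {m : {m : Mon // InVars (q + 1) m ∧ deg m = d} // monRank m.1 = q * d / 2} := by
  set w := q * d / 2 with hw
  obtain ⟨f, hf, hfi⟩ := exists_raise q d
  obtain ⟨g, hg, hgi⟩ := exists_lower q d
  let R : {m : Mon // InVars (q + 1) m ∧ deg m = d} →
    {m : Mon // InVars (q + 1) m ∧ deg m = d} → Prop := fun a b => ElemMove a.1 b.1
  have hfs : ∀ x, w - monRank x.1 ≠ 0 → w - monRank (f x).1 + 1 = w - monRank x.1 ∧ R x (f x) :=
    fun x hx => by
      obtain ⟨h1, h2⟩ := hf x (by omega)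
      exact ⟨by omega, h2⟩
  have hfi' : ∀ x y, w - monRank x.1 ≠ 0 → w - monRank x.1 = w - monRank y.1 → f x = f y →
    x = y := fun x y hx hxy => hfi x y (by omega) (by omega)
  have hgs : ∀ x, monRank x.1 - w ≠ 0 →
      monRank (g x).1 - w + 1 = monRank x.1 - w ∧ Function.swap R x (g x) := fun x hx => by
    obtain ⟨h1, h2⟩ := hg x (by omega)
    exact ⟨by omega, h2⟩
  have hgi' : ∀ x y, monRank x.1 - w ≠ 0 → monRank x.1 - w = monRank y.1 - w → g x = g y →
    x = y := fun x y hx hxy => hgi x y (by omega) (by omega)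
  have hval : ∀ a b, Relation.ReflTransGen R a b → Relation.ReflTransGen ElemMove a.1 b.1 :=
    fun a b h => h.lift Subtype.val fun _ _ h => h
  have hup : ∀ x, monRank x.1 ≤ w → monRank (f^[w - monRank x.1] x).1 = w := fun x hx => by
    have key : ∀ j ≤ w - monRank x.1, monRank (f^[j] x).1 = monRank x.1 + j := by
      intro j
      induction j with
      | zero => simp
      | succ j ih =>
        intro hj
        have h1 := ih (by omega)
        rw [Function.iterate_succ_apply', (hf _ (by omega)).1]
        omega
    have := key _ le_rfl
    omega
  have hdown : ∀ x, w ≤ monRank x.1 → monRank (g^[monRank x.1 - w] x).1 = w := fun x hx => by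
    have key : ∀ j ≤ monRank x.1 - w, monRank (g^[j] x).1 + j = monRank x.1 := by
      intro j
      induction j with
      | zero => simp
      | succ j ih =>
        intro hj
        have h1 := ih (by omega)
        have h2 := (hg (g^[j] x) (by omega)).1
        rw [Function.iterate_succ_apply']
        omega
    have := key _ le_rfl
    omega
  let p : {m : Mon // InVars (q + 1) m ∧ deg m = d} →
      {m : {m : Mon // InVars (q + 1) m ∧ deg m = d} // monRank m.1 = w} := fun x =>
    if hx : monRank x.1 ≤ w then ⟨_, hup x hx⟩ else ⟨_, hdown x (by omega)⟩
  have hcomp : ∀ x y, monRank x.1 ≤ monRank y.1 → p x = p y →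
      Relation.ReflTransGen ElemMove x.1 y.1 := by
    intro x y hxy he
    apply hval
    by_cases hy : monRank y.1 ≤ w
    · have hx : monRank x.1 ≤ w := by omega
      simp only [p, hx, hy, dif_pos, Subtype.mk.injEq] at he
      exact reflTransGen_of_iterate_eq hfs hfi' (by omega) he.symm
    · by_cases hx : monRank x.1 ≤ w
      · simp only [p, hx, hy, dif_pos, dif_neg, not_false_eq_true, Subtype.mk.injEq] at he
        have h1 := (iterate_height hfs _ x le_rfl).2
        have h2 := (iterate_height hgs _ y le_rfl).2
        rw [Relation.reflTransGen_swap, ← he] at h2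
        exact h1.trans h2
      · simp only [p, hx, hy, dif_neg, not_false_eq_true, Subtype.mk.injEq] at he
        have := reflTransGen_of_iterate_eq hgs hgi' (by omega) he
        rwa [Relation.reflTransGen_swap] at this
  have hinj : Function.Injective fun a : A => p a.1 := by
    rintro ⟨a, ha⟩ ⟨b, hb⟩ he
    by_contra hab
    have hab' : a ≠ b := fun h => hab (Subtype.ext h)
    rcases le_total (monRank a.1) (monRank b.1) with hle | hle
    · exact hA a ha b hb hab' (hcomp a b hle he)
    · exact hA b hb a ha hab'.symm (hcomp b a hle he.symm)
  simpa using Nat.card_le_card_of_injective _ hinj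

theorem finite_partitions (d q w : ℕ) :
    Finite {l : Fin d → ℕ // (∀ i j : Fin d, i ≤ j → l j ≤ l i) ∧ (∀ i, l i ≤ q) ∧
      ∑ i, l i = w} :=
  ((Set.finite_Iic (fun _ : Fin d => q)).subset fun _ hl => hl.2.1).to_subtype

/-- For `n ≥ 2`, `d ≥ 2`, the finite poset `(M_d^n, A_{n,d})`
has height `(n-1)·d` — there is a strictly increasing chain of `(n-1)·d + 1`
elements and no longer one — and width equal to the number of partitions of
`⌊(n-1)·d/2⌋` whose Young diagram fits inside a `d × (n-1)` box. -/
theorem stmt10 (n d : ℕ) (hn : 2 ≤ n) (hd : 2 ≤ d) :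
    (∃ c : Fin ((n - 1) * d + 1) → {m : Mon // InVars n m ∧ deg m = d},
      ∀ i j, i < j → c i ≠ c j ∧ Relation.ReflTransGen ElemMove (c j).1 (c i).1) ∧
    (∀ k : ℕ, ∀ c : Fin k → {m : Mon // InVars n m ∧ deg m = d},
      (∀ i j, i < j → c i ≠ c j ∧ Relation.ReflTransGen ElemMove (c j).1 (c i).1) →
      k ≤ (n - 1) * d + 1) ∧
    (∃ A : Finset {m : Mon // InVars n m ∧ deg m = d},
      (∀ a ∈ A, ∀ b ∈ A, a ≠ b → ¬ Relation.ReflTransGen ElemMove a.1 b.1) ∧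
      A.card = Nat.card {l : Fin d → ℕ // (∀ i j : Fin d, i ≤ j → l j ≤ l i) ∧
        (∀ i, l i ≤ n - 1) ∧ ∑ i, l i = (n - 1) * d / 2}) ∧
    (∀ A : Finset {m : Mon // InVars n m ∧ deg m = d},
      (∀ a ∈ A, ∀ b ∈ A, a ≠ b → ¬ Relation.ReflTransGen ElemMove a.1 b.1) →
      A.card ≤ Nat.card {l : Fin d → ℕ // (∀ i j : Fin d, i ≤ j → l j ≤ l i) ∧
        (∀ i, l i ≤ n - 1) ∧ ∑ i, l i = (n - 1) * d / 2}) := by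
  obtain ⟨q, rfl⟩ : ∃ q, n = q + 1 := ⟨n - 1, by omega⟩
  simp only [Nat.add_sub_cancel]
  obtain ⟨e⟩ := nonempty_partitions_equiv q d (q * d / 2)
  have := finite_partitions d q (q * d / 2)
  have hfin := Finite.of_equiv _ e
  rw [Nat.card_congr e]
  refine ⟨?_, ?_, ?_, ?_⟩
  · let top : {m : Mon // InVars (q + 1) m ∧ deg m = d} :=
      ⟨Finsupp.single q d, fun i hi => by
        have := Finsupp.support_single_subset hi
        rw [Finset.mem_singleton] at this
        omega, by simp [deg_eq_degree]⟩
    have htop : monRank top.1 = q * d := by rw [monRank_single, mul_comm]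
    have hstep : ∀ x : {m : Mon // InVars (q + 1) m ∧ deg m = d},
        ∃ y : {m : Mon // InVars (q + 1) m ∧ deg m = d}, monRank x.1 ≠ 0 →
          monRank y.1 + 1 = monRank x.1 ∧ ElemMove y.1 x.1 := fun x => by
      by_cases hx : monRank x.1 = 0
      · exact ⟨x, fun h => (h hx).elim⟩
      · obtain ⟨y, hy⟩ := exists_elemMove x hx
        exact ⟨y, fun _ => hy⟩
    choose h hh using hstep
    have hit := iterate_height
      (s := fun x : {m : Mon // InVars (q + 1) m ∧ deg m = d} => monRank x.1)
      (R := fun x y => ElemMove y.1 x.1) hh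
    refine ⟨fun i => h^[i.1] top, fun i j hij => ?_⟩
    have hbd : j.1 ≤ q * d := Nat.lt_succ_iff.1 j.2
    have hi := (hit i.1 top (by omega)).1
    obtain ⟨k, hk⟩ := Nat.exists_eq_add_of_lt hij
    obtain ⟨h1, h2⟩ := hit (k + 1) (h^[i.1] top) (by omega)
    rw [← Function.iterate_add_apply, show k + 1 + i.1 = j.1 by omega] at h1 h2
    refine ⟨fun he => ?_, ?_⟩
    · have := congrArg (fun x => monRank x.1) he
      dsimp only at this
      omega
    · exact (Relation.reflTransGen_swap.1 h2).lift Subtype.val fun _ _ h => h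
  · intro k c hc
    have hlt : ∀ i j, i < j → monRank (c j).1 < monRank (c i).1 := fun i j hij =>
      (eq_or_monRank_lt (hc i j hij).2).resolve_left fun he =>
        (hc i j hij).1 (Subtype.ext he.symm)
    have hinj : Function.Injective fun i => (⟨monRank (c i).1, Nat.lt_succ_of_le
        (monRank_le (c i).2.1 (c i).2.2)⟩ : Fin (q * d + 1)) := by
      intro i j he
      simp only [Fin.mk.injEq] at he
      rcases lt_trichotomy i j with hij | hij | hij
      · exact absurd he (hlt i j hij).ne'
      · exact hij
      · exact absurd he (hlt j i hij).ne
    simpa using Fintype.card_le_of_injective _ hinj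
  · have := Fintype.ofFinite {m : {m : Mon // InVars (q + 1) m ∧ deg m = d} //
      monRank m.1 = q * d / 2}
    refine ⟨Finset.univ.map (Function.Embedding.subtype fun m => monRank m.1 = q * d / 2), ?_, ?_⟩
    · intro a ha b hb hab h
      obtain ⟨a, -, rfl⟩ := Finset.mem_map.1 ha
      obtain ⟨b, -, rfl⟩ := Finset.mem_map.1 hb
      rcases eq_or_monRank_lt h with h | h
      · exact hab (Subtype.ext h)
      · exact h.ne (a.2.trans b.2.symm)
    · rw [Finset.card_map, Finset.card_univ, Nat.card_eq_fintype_card]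
  · exact fun A hA => card_antichain_le q d A hA
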